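/- Let φ be an even Schwartz function on ℝ whose Fourier transform φ̂ is supported in [−1/(n−a), 1/(n−a)], where n, a are integers with n − a ≥ 1 and 0 ≤ ℓ ≤ a − 1 ≤ ⌈n/2⌉ − 1. Define B̄(ℓ) = ∫_{ℝ^n} φ̂(y_1)⋯φ̂(y_n) · 𝟙_{|y_1+⋯+y_{n−ℓ}| − |y_{n−ℓ+1}| − ⋯ − |y_n| > 1} dy_1⋯dy_n. Then B̄(ℓ) = φ(0)^n − 2 ∫_{ℝ^{ℓ}} φ̂(x_2)⋯φ̂(x_{ℓ+1}) [ ∫_ℝ φ(x_1)^{n−ℓ} · sin(2π x_1 (1 + |x_2| + ⋯ + |x_{ℓ+1}|)) / (2π x_1) dx_1 ] dx_2⋯dx_{ℓ+1}. -/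

import Mathlib

open MeasureTheory Finset
open scoped FourierTransform

lemma four_facts (φ : SchwartzMap ℝ ℝ) (ψ : ℝ → ℝ)
    (hψ : ∀ y : ℝ, (ψ y : ℂ) =
      ∫ x : ℝ, (φ x : ℂ) * Complex.exp (-(2 * Real.pi * x * y) * Complex.I)) :
    Integrable ψ ∧ Integrable φ ∧ ∀ x : ℝ, (φ x : ℂ) =
      ∫ y : ℝ, (ψ y : ℂ) * Complex.exp ((2 * Real.pi * x * y) * Complex.I) := by
  let Φ : SchwartzMap ℝ ℂ := SchwartzMap.postcompCLM (𝕜 := ℝ) Complex.ofRealCLM φ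
  have hΦ : ∀ x, Φ x = (φ x : ℂ) := fun x => rfl
  have h1 : ∀ y, (𝓕 Φ) y = (ψ y : ℂ) := by
    intro y
    rw [hψ, SchwartzMap.fourier_coe, Real.fourier_real_eq_integral_exp_smul]
    congr 1; ext x
    rw [hΦ, smul_eq_mul, mul_comm]
    push_cast
    ring_nf
  refine ⟨?_, φ.integrable, ?_⟩
  · have := (𝓕 Φ).integrable (μ := volume)
    have h2 := this.re
    refine h2.congr (Filter.Eventually.of_forall fun y => ?_)
    simp [h1]
  · intro x
    have h3 : 𝓕⁻ (𝓕 Φ) = Φ := by simp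
    rw [← hΦ, ← h3, SchwartzMap.fourierInv_coe, Real.fourierInv_eq']
    congr 1; ext y
    rw [h1, smul_eq_mul, mul_comm]
    congr 2
    simp
    ring

lemma exp_meas_bd (a : ℝ) : ‖Complex.exp ((a:ℂ) * Complex.I)‖ ≤ 1 := by
  rw [Complex.norm_exp_ofReal_mul_I]

lemma inner_eval (φ : ℝ → ℝ) (hφ : Integrable φ) (ψ : ℝ → ℝ)
    (hψ : ∀ y : ℝ, (ψ y : ℂ) =
      ∫ x : ℝ, (φ x : ℂ) * Complex.exp (-(2 * Real.pi * x * y) * Complex.I))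
    (A c : ℝ) (hA : 0 ≤ A) :
    ∫ t : ℝ, (ψ t : ℂ) * (if |t + c| ≤ A then (1:ℂ) else 0) =
    ∫ x : ℝ, (φ x : ℂ) * Complex.exp ((2 * Real.pi * x * c) * Complex.I) *
      (2 * (Real.sin (2 * Real.pi * x * A) / (2 * Real.pi * x) : ℝ) : ℂ) := by
  have hset : ∀ t, |t + c| ≤ A ↔ t ∈ Set.Icc (-A - c) (A - c) := by
    intro t; rw [abs_le, Set.mem_Icc]; constructor <;> rintro ⟨h1, h2⟩ <;> constructor <;> linarith
  have hind : (fun t : ℝ => (if |t + c| ≤ A then (1:ℂ) else 0)) =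
      (Set.Icc (-A - c) (A - c)).indicator (fun _ => (1:ℂ)) := by
    ext t; simp [Set.indicator, hset]
  have hindI : Integrable (fun t : ℝ => (if |t + c| ≤ A then (1:ℂ) else 0)) := by
    rw [hind, integrable_indicator_iff measurableSet_Icc]
    exact integrableOn_const (by simp)
  have step1 : ∀ t : ℝ, (ψ t : ℂ) * (if |t + c| ≤ A then (1:ℂ) else 0) =
      ∫ x : ℝ, Complex.exp (-(2 * Real.pi * x * t) * Complex.I) *
        ((if |t + c| ≤ A then (1:ℂ) else 0) * (φ x : ℂ)) := by
    intro t
    rw [hψ, ← integral_mul_const]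
    congr 1; ext x; ring
  simp_rw [step1]
  rw [integral_integral_swap]
  · apply integral_congr_ae
    have : ∀ᵐ x : ℝ, x ≠ 0 := by simp [ae_iff]
    filter_upwards [this] with x hx
    have e1 : ∀ t : ℝ, Complex.exp (-(2 * Real.pi * x * t) * Complex.I) *
        ((if |t + c| ≤ A then (1:ℂ) else 0) * (φ x : ℂ)) =
        (φ x : ℂ) * (Set.Icc (-A - c) (A - c)).indicator
          (fun t : ℝ => Complex.exp ((-(2 * Real.pi * x) * Complex.I) * t)) t := by
      intro t
      by_cases h : |t + c| ≤ A
      · rw [if_pos h, Set.indicator_of_mem ((hset t).1 h)]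
        ring_nf
      · rw [if_neg h, Set.indicator_of_notMem (fun h' => h ((hset t).2 h'))]
        ring
    simp_rw [e1]
    rw [integral_const_mul, integral_indicator measurableSet_Icc, integral_Icc_eq_integral_Ioc,
      ← intervalIntegral.integral_of_le (by linarith)]
    have hpi : (Real.pi : ℂ) ≠ 0 := by exact_mod_cast Real.pi_ne_zero
    have hxc : (x : ℂ) ≠ 0 := by exact_mod_cast hx
    have hc : (-(2 * Real.pi * x) * Complex.I : ℂ) ≠ 0 := by
      simp [hx]
    rw [integral_exp_mul_complex hc, mul_assoc (φ x : ℂ)]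
    congr 1
    push_cast
    have hsin : Complex.sin (2 * Real.pi * x * A) = (Complex.exp (-(2 * Real.pi * x * A) * Complex.I) -
      Complex.exp ((2 * Real.pi * x * A) * Complex.I)) * Complex.I / 2 := rfl
    rw [hsin]
    have f1 : Complex.exp (-(2 * Real.pi * x) * Complex.I * (A - c)) =
      Complex.exp (2 * Real.pi * x * c * Complex.I) * Complex.exp (-(2 * Real.pi * x * A) * Complex.I) := by
      rw [← Complex.exp_add]; ring_nf
    have f2 : Complex.exp (-(2 * Real.pi * x) * Complex.I * (-A - c)) =
      Complex.exp (2 * Real.pi * x * c * Complex.I) * Complex.exp ((2 * Real.pi * x * A) * Complex.I) := by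
      rw [← Complex.exp_add]; ring_nf
    rw [f1, f2]
    field_simp
    rw [Complex.I_sq]
    ring
  · have := hindI.mul_prod (hφ.ofReal (𝕜 := ℂ))
    refine Integrable.bdd_mul (c := 1) this ?_ ?_
    · apply Continuous.aestronglyMeasurable
      fun_prop
    · refine Filter.Eventually.of_forall fun z => ?_
      have := exp_meas_bd (-(2 * Real.pi * z.2 * z.1))
      simpa using this

lemma kernel_bd (A x : ℝ) (hA : 0 ≤ A) :
    ‖(2 * (Real.sin (2 * Real.pi * x * A) / (2 * Real.pi * x) : ℝ) : ℂ)‖ ≤ 2 * A := by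
  rw [norm_mul, Complex.norm_real, Real.norm_eq_abs, abs_div]
  have h := Real.abs_sin_le_abs (x := 2 * Real.pi * x * A)
  rw [abs_mul _ A, abs_of_nonneg hA] at h
  have : |Real.sin (2 * Real.pi * x * A)| / |2 * Real.pi * x| ≤ A := by
    apply div_le_of_le_mul₀ (abs_nonneg _) hA; linarith
  simp only [Complex.norm_ofNat]; linarith

lemma key_eval (k : ℕ) (φ : ℝ → ℝ) (hφ : Integrable φ) (ψ : ℝ → ℝ) (hψi : Integrable ψ)
    (hψ : ∀ y : ℝ, (ψ y : ℂ) =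
      ∫ x : ℝ, (φ x : ℂ) * Complex.exp (-(2 * Real.pi * x * y) * Complex.I))
    (hinv : ∀ x : ℝ, (φ x : ℂ) =
      ∫ y : ℝ, (ψ y : ℂ) * Complex.exp ((2 * Real.pi * x * y) * Complex.I))
    (A : ℝ) (hA : 0 ≤ A) :
    ∫ u : Fin (k+1) → ℝ, (∏ i, ψ (u i)) * (if |∑ i, u i| ≤ A then (1:ℝ) else 0) =
    2 * ∫ x : ℝ, φ x ^ (k+1) * Real.sin (2 * Real.pi * x * A) / (2 * Real.pi * x) := by
  have hprod : Integrable (fun u : Fin (k+1) → ℝ => ∏ i, ψ (u i)) := Integrable.fintype_prod (fun _ => hψi)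
  have hprod' : Integrable (fun u : Fin k → ℝ => ∏ i, (ψ (u i) : ℂ)) :=
    Integrable.fintype_prod (f := fun _ y => (ψ y : ℂ)) (fun _ => hψi.ofReal)
  have hfull : Integrable (fun u : Fin (k+1) → ℝ => (∏ i, ψ (u i)) * (if |∑ i, u i| ≤ A then (1:ℝ) else 0)) := by
    refine Integrable.mul_bdd (c := 1) hprod ?_ ?_
    · apply Measurable.aestronglyMeasurable
      exact Measurable.ite (measurableSet_le (by fun_prop) (by fun_prop)) (by fun_prop) (by fun_prop)
    · refine Filter.Eventually.of_forall fun z => ?_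
      split_ifs <;> simp
  have mp := (volume_preserving_piFinSuccAbove (fun _ : Fin (k+1) => ℝ) 0).symm
  rw [← Complex.ofReal_inj]
  rw [← mp.integral_comp' ]
  have hfull' := (mp.integrable_comp_emb (MeasurableEquiv.measurableEmbedding _)).2 hfull
  rw [Measure.volume_eq_prod, ← integral_complex_ofReal, integral_prod_symm _ hfull'.ofReal]
  have e1 : ∀ u' : Fin k → ℝ, ∫ t : ℝ, ((((∏ i, ψ ((MeasurableEquiv.piFinSuccAbove (fun _ : Fin (k+1) => ℝ) 0).symm (t, u') i)) *
      (if |∑ i, (MeasurableEquiv.piFinSuccAbove (fun _ : Fin (k+1) => ℝ) 0).symm (t, u') i| ≤ A then (1:ℝ) else 0) : ℝ)) : ℂ)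
      = ∫ x : ℝ, Complex.exp ((2 * Real.pi * x * ∑ i, u' i : ℝ) * Complex.I) *
        ((∏ i, (ψ (u' i) : ℂ)) * ((2 * (Real.sin (2 * Real.pi * x * A) / (2 * Real.pi * x) : ℝ) : ℂ) * (φ x : ℂ))) := by
    intro u'
    have := inner_eval φ hφ ψ hψ A (∑ i, u' i) hA
    trans (∏ i, (ψ (u' i) : ℂ)) * ∫ t : ℝ, (ψ t : ℂ) * (if |t + ∑ i, u' i| ≤ A then (1:ℂ) else 0)
    · rw [← integral_const_mul]
      congr 1; ext t
      simp [MeasurableEquiv.piFinSuccAbove, Fin.prod_univ_succ, Fin.sum_univ_succ]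
      split_ifs <;> simp [mul_comm]
    · rw [this, ← integral_const_mul]
      congr 1; ext x
      push_cast
      ring
  erw [integral_congr_ae (Filter.Eventually.of_forall e1)]
  rw [integral_integral_swap]
  · push_cast
    rw [← integral_complex_ofReal, ← integral_const_mul]
    congr 1; ext x
    have : ∫ u : Fin k → ℝ, ∏ i, ((ψ (u i) : ℂ) * Complex.exp ((2 * Real.pi * x * u i) * Complex.I)) = (φ x : ℂ) ^ k := by
      rw [integral_fintype_prod_volume_eq_pow (fun y : ℝ => (ψ y : ℂ) * Complex.exp ((2 * Real.pi * x * y) * Complex.I)), ← hinv]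
      simp
    trans (∫ u : Fin k → ℝ, ∏ i, ((ψ (u i) : ℂ) * Complex.exp ((2 * Real.pi * x * u i) * Complex.I))) *
      ((2 * (Real.sin (2 * Real.pi * x * A) / (2 * Real.pi * x) : ℝ) : ℂ) * (φ x : ℂ))
    · rw [← integral_mul_const]
      congr 1; ext u
      rw [Finset.prod_mul_distrib, ← Complex.exp_sum]
      push_cast
      rw [Finset.mul_sum, Finset.sum_mul]
      ring
    · rw [this]; push_cast; ring
  · have hK : Integrable (fun x : ℝ => (2 * (Real.sin (2 * Real.pi * x * A) / (2 * Real.pi * x) : ℝ) : ℂ) * (φ x : ℂ)) := by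
      refine Integrable.bdd_mul (c := 2 * A) hφ.ofReal ?_ (Filter.Eventually.of_forall fun x => kernel_bd A x hA)
      apply Measurable.aestronglyMeasurable
      fun_prop
    refine Integrable.bdd_mul (c := 1) (hprod'.mul_prod hK) ?_ ?_
    · apply Continuous.aestronglyMeasurable
      fun_prop
    · exact Filter.Eventually.of_forall fun z => exp_meas_bd _

theorem Bbar_eval (n a ℓ : ℕ) (hna : 1 ≤ n - a) (hℓ : ℓ + 1 ≤ a) (ha : a ≤ (n + 1) / 2)
    (φ : SchwartzMap ℝ ℝ) (heven : ∀ x, φ (-x) = φ x)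
    (ψ : ℝ → ℝ)
    (hψ : ∀ y : ℝ, (ψ y : ℂ) =
      ∫ x : ℝ, (φ x : ℂ) * Complex.exp (-(2 * Real.pi * x * y) * Complex.I))
    (hsupp : ∀ y : ℝ, ψ y ≠ 0 → |y| ≤ 1 / ((n : ℝ) - (a : ℝ))) :
    (∫ y : Fin n → ℝ, (∏ i, ψ (y i)) *
        (if 1 < |∑ i ∈ Finset.univ.filter (fun i : Fin n => (i : ℕ) < n - ℓ), y i|
              - ∑ i ∈ Finset.univ.filter (fun i : Fin n => n - ℓ ≤ (i : ℕ)), |y i|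
          then (1 : ℝ) else 0))
      = φ 0 ^ n - 2 * ∫ v : Fin ℓ → ℝ, (∏ j, ψ (v j)) *
          ∫ x : ℝ, φ x ^ (n - ℓ) *
            Real.sin (2 * Real.pi * x * (1 + ∑ j, |v j|)) / (2 * Real.pi * x) := by
  obtain ⟨hψi, hφ, hinv⟩ := four_facts φ ψ hψ
  obtain ⟨k, rfl⟩ : ∃ k, n = (k + 1) + ℓ := ⟨n - ℓ - 1, by omega⟩
  clear hsupp hna hℓ ha heven
  have hm : k + 1 + ℓ - ℓ = k + 1 := by omega
  rw [hm]
  have h0 : ∫ y, ψ y = φ 0 := by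
    have := hinv 0
    simp only [Complex.ofReal_zero, mul_zero, zero_mul, Complex.exp_zero, mul_one] at this
    rw [integral_complex_ofReal] at this
    exact_mod_cast this.symm
  have hprod : Integrable (fun u : Fin (k+1+ℓ) → ℝ => ∏ i, ψ (u i)) := Integrable.fintype_prod (fun _ => hψi)
  let F : (Fin (k+1+ℓ) → ℝ) → ℝ := fun y => (∏ i, ψ (y i)) *
    (if |∑ i : Fin (k+1), y (Fin.castAdd ℓ i)| ≤ 1 + ∑ j : Fin ℓ, |y (Fin.natAdd (k+1) j)| then (1:ℝ) else 0)
  have hF : Integrable F := by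
    refine Integrable.mul_bdd (c := 1) hprod ?_ ?_
    · apply Measurable.aestronglyMeasurable
      exact Measurable.ite (measurableSet_le (by fun_prop) (by fun_prop)) (by fun_prop) (by fun_prop)
    · refine Filter.Eventually.of_forall fun z => ?_
      split_ifs <;> simp
  have s1 : ∀ y : Fin (k+1+ℓ) → ℝ, ∑ i ∈ Finset.univ.filter (fun i : Fin (k+1+ℓ) => (i : ℕ) < k+1), y i
      = ∑ i : Fin (k+1), y (Fin.castAdd ℓ i) := by
    intro y
    rw [Finset.sum_filter, Fin.sum_univ_add]
    have q1 : ∀ i : Fin (k+1), ((Fin.castAdd ℓ i : Fin (k+1+ℓ)) : ℕ) < k + 1 := fun i => i.2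
    have q2 : ∀ j : Fin ℓ, ¬ ((Fin.natAdd (k+1) j : Fin (k+1+ℓ)) : ℕ) < k + 1 := fun j => by simp; omega
    simp only [q1, q2, if_true, if_false, Finset.sum_const_zero, add_zero]
  have s2 : ∀ y : Fin (k+1+ℓ) → ℝ, ∑ i ∈ Finset.univ.filter (fun i : Fin (k+1+ℓ) => k+1 ≤ (i : ℕ)), |y i|
      = ∑ j : Fin ℓ, |y (Fin.natAdd (k+1) j)| := by
    intro y
    rw [Finset.sum_filter, Fin.sum_univ_add]
    have q1 : ∀ i : Fin (k+1), ¬ k + 1 ≤ ((Fin.castAdd ℓ i : Fin (k+1+ℓ)) : ℕ) := fun i => by simp; omega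
    have q2 : ∀ j : Fin ℓ, k + 1 ≤ ((Fin.natAdd (k+1) j : Fin (k+1+ℓ)) : ℕ) := fun j => by simp
    simp only [q1, q2, if_true, if_false, Finset.sum_const_zero, zero_add]
  simp_rw [s1, s2]
  have hsplit : ∀ y : Fin (k+1+ℓ) → ℝ, (∏ i, ψ (y i)) *
      (if 1 < |∑ i : Fin (k+1), y (Fin.castAdd ℓ i)| - ∑ j : Fin ℓ, |y (Fin.natAdd (k+1) j)| then (1:ℝ) else 0)
      = (∏ i, ψ (y i)) - F y := by
    intro y
    simp only [F]
    split_ifs <;> first | (exfalso; linarith) | ring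
  simp_rw [hsplit]
  rw [integral_sub hprod hF, integral_fintype_prod_volume_eq_pow ψ, h0, Fintype.card_fin]
  congr 1
  have mp := (volume_measurePreserving_piCongrLeft (fun _ : Fin (k+1+ℓ) => ℝ) finSumFinEquiv).comp
    (volume_measurePreserving_sumPiEquivProdPi_symm (fun _ : Fin (k+1) ⊕ Fin ℓ => ℝ))
  let E := (MeasurableEquiv.sumPiEquivProdPi (fun _ : Fin (k+1) ⊕ Fin ℓ => ℝ)).symm.trans
    (MeasurableEquiv.piCongrLeft (fun _ : Fin (k+1+ℓ) => ℝ) finSumFinEquiv)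
  have mpE : MeasurePreserving E := mp
  have hE1 : ∀ p i, E p (Fin.castAdd ℓ i) = p.1 i := by
    intro p i
    have := Equiv.piCongrLeft_apply_apply (fun _ : Fin (k+1+ℓ) => ℝ) finSumFinEquiv
      ((MeasurableEquiv.sumPiEquivProdPi (fun _ : Fin (k+1) ⊕ Fin ℓ => ℝ)).symm p) (Sum.inl i)
    rw [finSumFinEquiv_apply_left] at this
    exact this
  have hE2 : ∀ p j, E p (Fin.natAdd (k+1) j) = p.2 j := by
    intro p j
    have := Equiv.piCongrLeft_apply_apply (fun _ : Fin (k+1+ℓ) => ℝ) finSumFinEquiv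
      ((MeasurableEquiv.sumPiEquivProdPi (fun _ : Fin (k+1) ⊕ Fin ℓ => ℝ)).symm p) (Sum.inr j)
    rw [finSumFinEquiv_apply_right] at this
    exact this
  rw [← mpE.integral_comp']
  have hFE : Integrable (fun p => F (E p)) := (mpE.integrable_comp_emb E.measurableEmbedding).2 hF
  rw [Measure.volume_eq_prod] at hFE ⊢
  rw [integral_prod_symm _ hFE, ← integral_const_mul]
  congr 1; ext v
  have := key_eval k φ hφ ψ hψi hψ hinv (1 + ∑ j, |v j|) (by positivity)
  rw [mul_left_comm, ← this, ← integral_const_mul]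
  congr 1; ext u
  simp only [F, Fin.prod_univ_add, hE1, hE2]
  ring
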